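/- arXiv:1312.5126 — 10 statements merged into one kernel-verified Lean document; each statement's English description precedes it below -/
import Mathlib

section
/- Let a, b be positive integers and c a positive rational number with c < a < b and a not dividing b. Then there exists a positive integer μ such that L(a,b,c) = ⌈μ·b/a⌉, where ⌈μ·b/a⌉ is the ceiling of the rational number μ·b/a. -/
/-- The least positive solution of the proportionally modular Diophantine
inequality `(a*x mod b) ≤ c*x`. -/
noncomputable def L (a b : ℕ) (c : ℚ) : ℕ :=
  sInf {x : ℕ | 0 < x ∧ ((a * x % b : ℕ) : ℚ) ≤ c * x}

theorem stmt_5 (a b : ℕ) (c : ℚ) (ha : 0 < a) (hb : 0 < b) (hc : 0 < c)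
    (hca : c < (a : ℚ)) (hab : a < b) (hndvd : ¬ a ∣ b) :
    ∃ μ : ℕ, 0 < μ ∧ (L a b c : ℤ) = ⌈((μ : ℚ) * b) / a⌉ := by
  have hne : {x : ℕ | 0 < x ∧ ((a * x % b : ℕ) : ℚ) ≤ c * x}.Nonempty :=
    ⟨b, hb, by rw [Nat.mul_mod_left]; push_cast; positivity⟩
  obtain ⟨hpos, hle⟩ : 0 < L a b c ∧ ((a * L a b c % b : ℕ) : ℚ) ≤ c * L a b c :=
    Nat.sInf_mem hne
  have hmin : ∀ y : ℕ, 0 < y → ((a * y % b : ℕ) : ℚ) ≤ c * y → L a b c ≤ y :=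
    fun y hy h => Nat.sInf_le ⟨hy, h⟩
  generalize L a b c = x at hpos hle hmin ⊢
  have hdiv : b * (a * x / b) + a * x % b = a * x := Nat.div_add_mod _ _
  have hlt : a * x % b < b := Nat.mod_lt _ hb
  generalize a * x / b = q at hdiv ⊢
  generalize a * x % b = r at hdiv hle hlt
  have hxpos : (0 : ℚ) < x := by exact_mod_cast hpos
  have hq : 0 < q := by
    rcases Nat.eq_zero_or_pos q with rfl | h
    · have hr : (r : ℚ) = a * x := by exact_mod_cast (by simpa using hdiv)
      nlinarith
    · exact h
  -- If `a ≤ r`, then `x - 1` would be a smaller positive solution.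
  have hra : r < a := by
    by_contra! har
    obtain ⟨y, rfl⟩ : ∃ y, x = y + 1 := ⟨x - 1, by omega⟩
    obtain ⟨s, rfl⟩ : ∃ s, r = s + a := ⟨r - a, by omega⟩
    have hy : a * y = s + b * q := by linarith
    have hypos : 0 < y := by
      by_contra! h
      have := Nat.mul_pos hb hq
      obtain rfl : y = 0 := by omega
      omega
    have hmod : a * y % b = s := by
      rw [hy, Nat.add_mul_mod_self_left, Nat.mod_eq_of_lt (by omega)]
    have := hmin y hypos (by rw [hmod]; push_cast at hle; linarith)
    omega
  have haQ : (0 : ℚ) < a := by exact_mod_cast ha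
  have hdivQ : (b : ℚ) * q + r = a * x := by exact_mod_cast hdiv
  have hraQ : (r : ℚ) < a := by exact_mod_cast hra
  have hrQ : (0 : ℚ) ≤ r := r.cast_nonneg
  refine ⟨q, hq, ?_⟩
  symm
  rw [Int.ceil_eq_iff, lt_div_iff₀ haQ, div_le_iff₀ haQ]
  push_cast
  constructor <;> linarith
end

section
/- Let a, b be positive integers and c a positive rational number with c < a < b and a not dividing b. Let μ be a positive integer such that L(a,b,c) = ⌈μ·b/a⌉, and let R_μ be the unique positive integer satisfying (R_μ − 1)·a/(b mod a) < μ ≤ R_μ·a/(b mod a). Then L(a,b,c) = μ·⌊b/a⌋ + R_μ. -/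
theorem stmt_7 (a b : ℕ) (c : ℚ) (ha : 0 < a) (hb : 0 < b) (hc : 0 < c)
    (hca : c < (a : ℚ)) (hab : a < b) (hndvd : ¬ a ∣ b)
    (μ R : ℕ) (hμ : 0 < μ) (hL : (L a b c : ℤ) = ⌈((μ : ℚ) * b) / a⌉)
    (hR : 0 < R)
    (hR1 : ((R : ℚ) - 1) * a / (b % a : ℕ) < (μ : ℚ))
    (hR2 : (μ : ℚ) ≤ (R : ℚ) * a / (b % a : ℕ)) :
    L a b c = μ * (b / a) + R := by
  have hr : (0 : ℚ) < (b % a : ℕ) := by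
    exact_mod_cast Nat.pos_of_ne_zero fun h => hndvd (Nat.dvd_of_mod_eq_zero h)
  have ha' : (0 : ℚ) < a := by exact_mod_cast ha
  have hdiv : (b : ℚ) = a * (b / a : ℕ) + (b % a : ℕ) := by
    exact_mod_cast (Nat.div_add_mod b a).symm
  rw [div_lt_iff₀ hr] at hR1
  rw [le_div_iff₀ hr] at hR2
  have hceil : ⌈((μ : ℚ) * b) / a⌉ = ((μ * (b / a) + R : ℕ) : ℤ) := by
    rw [Int.ceil_eq_iff, lt_div_iff₀ ha', div_le_iff₀ ha', hdiv, Int.cast_natCast,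
      Nat.cast_add, Nat.cast_mul]
    constructor <;> linarith
  exact_mod_cast hL.trans hceil
end

section
/- Let a, b be positive integers and c a positive rational number with c < a < b and a not dividing b. Let μ be a positive integer such that L(a,b,c) = ⌈μ·b/a⌉, and let R_μ be the unique positive integer satisfying (R_μ − 1)·a/(b mod a) < μ ≤ R_μ·a/(b mod a). Then (a·L(a,b,c)) mod b = R_μ·a − μ·(b mod a). -/
theorem stmt_8 (a b : ℕ) (c : ℚ) (ha : 0 < a) (hb : 0 < b) (hc : 0 < c)
    (hca : c < (a : ℚ)) (hab : a < b) (hndvd : ¬ a ∣ b)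
    (μ R : ℕ) (hμ : 0 < μ) (hL : (L a b c : ℤ) = ⌈((μ : ℚ) * b) / a⌉)
    (hR : 0 < R)
    (hR1 : ((R : ℚ) - 1) * a / (b % a : ℕ) < (μ : ℚ))
    (hR2 : (μ : ℚ) ≤ (R : ℚ) * a / (b % a : ℕ)) :
    ((a * L a b c % b : ℕ) : ℤ) = (R : ℤ) * a - (μ : ℤ) * (b % a : ℕ) := by
  have ha' : (0 : ℚ) < a := by exact_mod_cast ha
  have hr : 0 < b % a := Nat.pos_of_ne_zero fun h ↦ hndvd (Nat.dvd_of_mod_eq_zero h)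
  have hr' : (0 : ℚ) < (b % a : ℕ) := by exact_mod_cast hr
  rw [div_lt_iff₀ hr'] at hR1
  rw [le_div_iff₀ hr'] at hR2
  obtain ⟨hL1, hL2⟩ := Int.ceil_eq_iff.mp hL.symm
  rw [lt_div_iff₀ ha'] at hL1
  rw [div_le_iff₀ ha'] at hL2
  generalize L a b c = l at *
  have hbr : (b : ℤ) = a * (b / a : ℕ) + (b % a : ℕ) := by exact_mod_cast (Nat.div_add_mod b a).symm
  generalize b % a = r at *
  generalize b / a = q at *
  replace hR1 : ((R : ℤ) - 1) * a < μ * r := by exact_mod_cast hR1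
  replace hR2 : (μ : ℤ) * r ≤ R * a := by exact_mod_cast hR2
  replace hL1 : ((l : ℤ) - 1) * a < μ * b := by exact_mod_cast hL1
  replace hL2 : (μ : ℤ) * b ≤ l * a := by exact_mod_cast hL2
  have haz : (0 : ℤ) < a := by exact_mod_cast ha
  have habz : (a : ℤ) < b := by exact_mod_cast hab
  have hl : (l : ℤ) = μ * q + R := by
    rw [hbr] at hL1 hL2
    apply le_antisymm
    · refine Int.le_of_lt_add_one (lt_of_mul_lt_mul_right ?_ haz.le)
      linarith
    · refine Int.le_of_lt_add_one (lt_of_mul_lt_mul_right ?_ haz.le)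
      linarith
  have key : (a : ℤ) * l = (R * a - μ * r) + b * μ := by
    rw [hl, hbr]
    ring
  push_cast
  rw [key, Int.add_mul_emod_self_left]
  exact Int.emod_eq_of_lt (by linarith) (by linarith)
end

section
/- Let a, b be positive integers and c a positive rational number with c < a < b and a not dividing b. Let μ be a positive integer such that L(a,b,c) = ⌈μ·b/a⌉, and let R_μ be the unique positive integer satisfying (R_μ − 1)·a/(b mod a) < μ ≤ R_μ·a/(b mod a). Then R_μ = L( a mod (b mod a), b mod a, c·b/(c·⌊b/a⌋ + (b mod a)) ). -/
theorem L_le {a b x : ℕ} {c : ℚ} (hx : 0 < x) (h : ((a * x % b : ℕ) : ℚ) ≤ c * x) :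
    L a b c ≤ x :=
  Nat.sInf_le ⟨hx, h⟩

theorem L_mem {a b : ℕ} {c : ℚ} (hb : 0 < b) (hc : 0 ≤ c) :
    0 < L a b c ∧ ((a * L a b c % b : ℕ) : ℚ) ≤ c * L a b c :=
  Nat.sInf_mem (s := {x : ℕ | 0 < x ∧ ((a * x % b : ℕ) : ℚ) ≤ c * x})
    ⟨b, hb, by simpa using by positivity⟩

theorem Nat.cast_mod_le_sub {m k n : ℕ} (h : k * n ≤ m) :
    ((m % n : ℕ) : ℚ) ≤ m - k * n := by
  obtain ⟨t, rfl⟩ := Nat.exists_eq_add_of_le h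
  have : (k * n + t) % n ≤ t := by
    rw [Nat.mul_add_mod_self_right]
    exact Nat.mod_le t n
  have : (((k * n + t) % n : ℕ) : ℚ) ≤ t := by exact_mod_cast this
  push_cast at this ⊢
  linarith

theorem stmt_9 (a b : ℕ) (c : ℚ) (ha : 0 < a) (hb : 0 < b) (hc : 0 < c)
    (hca : c < (a : ℚ)) (hab : a < b) (hndvd : ¬ a ∣ b)
    (μ R : ℕ) (hμ : 0 < μ) (hL : (L a b c : ℤ) = ⌈((μ : ℚ) * b) / a⌉)
    (hR : 0 < R)
    (hR1 : ((R : ℚ) - 1) * a / (b % a : ℕ) < (μ : ℚ))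
    (hR2 : (μ : ℚ) ≤ (R : ℚ) * a / (b % a : ℕ)) :
    R = L (a % (b % a)) (b % a)
          (c * b / (c * ((b / a : ℕ) : ℚ) + ((b % a : ℕ) : ℚ))) := by
  have hr : 0 < b % a := Nat.pos_of_ne_zero fun h => hndvd (Nat.dvd_of_mod_eq_zero h)
  have hbN : b = (b / a) * a + b % a := by rw [mul_comm]; exact (Nat.div_add_mod b a).symm
  generalize hrdef : b % a = r at *
  generalize hqdef : b / a = q at *
  have hbQ : (b : ℚ) = q * a + r := by exact_mod_cast hbN
  have hrQ : (0 : ℚ) < r := by exact_mod_cast hr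
  have haQ : (0 : ℚ) < a := by exact_mod_cast ha
  rw [div_lt_iff₀ hrQ] at hR1
  rw [le_div_iff₀ hrQ] at hR2
  have hLeq : L a b c = q * μ + R := by
    have h : ⌈((μ : ℚ) * b) / a⌉ = ((q * μ + R : ℕ) : ℤ) := by
      rw [Int.ceil_eq_iff, lt_div_iff₀ haQ, div_le_iff₀ haQ, hbQ]
      push_cast
      constructor <;> nlinarith
    exact_mod_cast hL.trans h
  have hD : 0 < c * q + (r : ℚ) := by positivity
  have key : ∀ k y : ℚ, a * y - k * r ≤ c * b / (c * q + r) * y ↔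
      a * (q * k + y) - k * b ≤ c * (q * k + y) := by
    intro k y
    rw [div_mul_eq_mul_div, le_div_iff₀ hD, hbQ, ← mul_le_mul_iff_right₀ hrQ
      (b := a * (q * k + y) - k * (q * a + r))]
    constructor <;> intro h <;> linarith
  apply le_antisymm
  · obtain ⟨hy, hys⟩ := L_mem (a := a % r) (c := c * b / (c * q + r)) hr (by positivity)
    generalize L (a % r) r (c * b / (c * q + r)) = y at *
    by_contra! hlt
    rw [Nat.mod_mul_mod] at hys
    have hdm : (r : ℚ) * (a * y / r : ℕ) + (a * y % r : ℕ) = a * y := by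
      exact_mod_cast Nat.div_add_mod (a * y) r
    generalize a * y / r = k at *
    have hk := (key k y).1 (by linarith)
    have hrk : (k : ℚ) * r ≤ a * y := by
      have : (0 : ℚ) ≤ (a * y % r : ℕ) := by positivity
      linarith
    have hxk : k * b ≤ a * (q * k + y) := by
      rw [hbN]
      have : k * r ≤ a * y := by exact_mod_cast hrk
      nlinarith
    have hle : L a b c ≤ q * k + y := by
      refine L_le (by omega) ((Nat.cast_mod_le_sub hxk).trans ?_)
      push_cast
      exact hk
    have hkμ : k < μ := by
      have hyR : (y : ℚ) + 1 ≤ R := by exact_mod_cast hlt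
      have : (k : ℚ) * r < μ * r := by nlinarith
      exact_mod_cast lt_of_mul_lt_mul_right this hrQ.le
    have := Nat.mul_le_mul_left q hkμ.le
    omega
  · refine L_le hR ?_
    rw [Nat.mod_mul_mod]
    have hμR : μ * r ≤ a * R := by rw [mul_comm a]; exact_mod_cast hR2
    refine (Nat.cast_mod_le_sub hμR).trans ?_
    push_cast
    rw [key]
    have hmem := (L_mem (a := a) (c := c) hb hc.le).2
    rw [hLeq] at hmem
    have hdiv : a * (q * μ + R) / b = μ := by
      have h1 : R * a < μ * r + a := by
        have : (R : ℚ) * a < μ * r + a := by linarith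
        exact_mod_cast this
      have h2 : a * (q * μ + R) + μ * r = μ * b + R * a := by rw [hbN]; ring
      apply Nat.div_eq_of_lt_le <;> nlinarith
    have hdm : (b : ℚ) * (a * (q * μ + R) / b : ℕ) + (a * (q * μ + R) % b : ℕ)
        = a * (q * μ + R) := by
      exact_mod_cast Nat.div_add_mod (a * (q * μ + R)) b
    rw [hdiv] at hdm
    push_cast at hmem
    linarith
end

section
/- Let a, b be positive integers and c a positive rational number with c < a < b and a not dividing b. Set L₁ = L( a mod (b mod a), b mod a, c·b/(c·⌊b/a⌋ + (b mod a)) ). Then L(a,b,c) = ⌈ ⌈ L₁·(a − c) / (c·⌊b/a⌋ + (b mod a)) ⌉ · b / a ⌉. -/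
/-- A residue is bounded by `t` as soon as some nonnegative representative is. -/
theorem natCast_mod_le_iff_exists_int {b : ℕ} (hb : 0 < b) (m : ℕ) (t : ℚ) :
    ((m % b : ℕ) : ℚ) ≤ t ↔ ∃ y : ℤ, (y : ℚ) * b ≤ m ∧ (m : ℚ) - y * b ≤ t := by
  have hm : ((m % b : ℕ) : ℚ) = m - ((m / b : ℕ) : ℚ) * b := by
    have h : ((b * (m / b) + m % b : ℕ) : ℚ) = m := by rw [Nat.div_add_mod]
    push_cast at h ⊢
    linarith
  constructor
  · intro h
    refine ⟨((m / b : ℕ) : ℤ), ?_, ?_⟩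
    · have : (0 : ℚ) ≤ ((m % b : ℕ) : ℚ) := Nat.cast_nonneg _
      rw [Int.cast_natCast]
      linarith
    · rw [Int.cast_natCast, ← hm]
      exact h
  · rintro ⟨y, hy, hyt⟩
    have hyb : y * b ≤ m := by exact_mod_cast hy
    have hle : y ≤ ((m / b : ℕ) : ℤ) := by
      rw [Int.natCast_div]
      exact (Int.le_ediv_iff_mul_le (by exact_mod_cast hb)).2 hyb
    have hle' : (y : ℚ) ≤ (((m / b : ℕ) : ℤ) : ℚ) := Int.cast_le.2 hle
    rw [Int.cast_natCast] at hle'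
    have := mul_le_mul_of_nonneg_right hle' (Nat.cast_nonneg (α := ℚ) b)
    linarith

theorem L_spec (a : ℕ) {b : ℕ} {c : ℚ} (hb : 0 < b) (hc : 0 ≤ c) :
    0 < L a b c ∧ ((a * L a b c % b : ℕ) : ℚ) ≤ c * L a b c :=
  Nat.sInf_mem (s := {x : ℕ | 0 < x ∧ ((a * x % b : ℕ) : ℚ) ≤ c * x})
    ⟨b, hb, by rw [Nat.mul_mod_left]; push_cast; positivity⟩

theorem stmt_11 (a b : ℕ) (c : ℚ) (ha : 0 < a) (hb : 0 < b) (hc : 0 < c)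
    (hca : c < (a : ℚ)) (hab : a < b) (hndvd : ¬ a ∣ b)
    (L₁ : ℕ)
    (hL₁ : L₁ = L (a % (b % a)) (b % a)
            (c * b / (c * ((b / a : ℕ) : ℚ) + ((b % a : ℕ) : ℚ)))) :
    (L a b c : ℤ) =
      ⌈((⌈(L₁ : ℚ) * ((a : ℚ) - c) /
          (c * ((b / a : ℕ) : ℚ) + ((b % a : ℕ) : ℚ))⌉ : ℤ) : ℚ) * b / a⌉ := by
  have hr : 0 < b % a := Nat.pos_of_ne_zero fun h => hndvd (Nat.dvd_of_mod_eq_zero h)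
  have hbq : (b : ℚ) = a * ((b / a : ℕ) : ℚ) + ((b % a : ℕ) : ℚ) := by
    exact_mod_cast (Nat.div_add_mod b a).symm
  generalize b / a = q at *
  generalize b % a = r at *
  have haQ : (0 : ℚ) < a := by exact_mod_cast ha
  have hbQ : (0 : ℚ) < b := by exact_mod_cast hb
  have hrQ : (0 : ℚ) < r := by exact_mod_cast hr
  have hqQ : (0 : ℚ) ≤ q := Nat.cast_nonneg q
  have hac : 0 < (a : ℚ) - c := sub_pos.2 hca
  obtain ⟨D, hD⟩ : ∃ D : ℚ, D = c * q + r := ⟨_, rfl⟩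
  rw [← hD] at hL₁ ⊢
  have hD0 : 0 < D := by rw [hD]; positivity
  -- Membership in the reduced solution set, as a two-sided bound on an integer multiple.
  have key (z : ℕ) : (((a % r) * z % r : ℕ) : ℚ) ≤ c * b / D * z ↔
      ∃ y : ℤ, (y : ℚ) * r ≤ a * z ∧ z * ((a : ℚ) - c) ≤ y * D := by
    rw [Nat.mod_mul_mod, natCast_mod_le_iff_exists_int hr]
    refine exists_congr fun y => ?_
    push_cast
    refine and_congr_right fun _ => ?_
    have e : r * (y * D) - r * (z * ((a : ℚ) - c)) = c * b * z - (a * z - y * r) * D := by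
      rw [hbq, hD]; ring
    rw [div_mul_eq_mul_div, le_div_iff₀ hD0, ← sub_nonneg, ← e, ← mul_sub,
      mul_nonneg_iff_of_pos_left hrQ, sub_nonneg]
  obtain ⟨hL₁0, hL₁m⟩ := L_spec (a % r) (c := c * b / D) hr (by positivity)
  rw [← hL₁] at hL₁0 hL₁m
  obtain ⟨w, hw1, hw2⟩ := (key L₁).1 hL₁m
  have hL₁Q : (0 : ℚ) < L₁ := by exact_mod_cast hL₁0
  obtain ⟨y₀, hy₀⟩ : ∃ y₀ : ℤ, y₀ = ⌈(L₁ : ℚ) * ((a : ℚ) - c) / D⌉ := ⟨_, rfl⟩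
  rw [← hy₀]
  have hy₀pos : 0 < y₀ := by rw [hy₀]; exact Int.ceil_pos.2 (by positivity)
  have hy₀Q : (0 : ℚ) < y₀ := by exact_mod_cast hy₀pos
  have hy₀D : L₁ * ((a : ℚ) - c) ≤ y₀ * D := by
    rw [← div_le_iff₀ hD0, hy₀]; exact Int.le_ceil _
  have hy₀w : y₀ ≤ w := by rw [hy₀]; exact Int.ceil_le.2 ((div_le_iff₀ hD0).2 hw2)
  obtain ⟨x₀, hx₀⟩ : ∃ x₀ : ℕ, (x₀ : ℤ) = ⌈(y₀ : ℚ) * b / a⌉ :=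
    Int.eq_ofNat_of_zero_le (Int.ceil_nonneg (by positivity)) |>.imp fun _ h => h.symm
  have hx₀pos : 0 < x₀ := by
    have : 0 < ⌈(y₀ : ℚ) * b / a⌉ := Int.ceil_pos.2 (by positivity)
    omega
  have hx₀a : (y₀ : ℚ) * b ≤ a * x₀ := by
    rw [mul_comm (a : ℚ), ← div_le_iff₀ haQ]
    calc (y₀ : ℚ) * b / a ≤ (⌈(y₀ : ℚ) * b / a⌉ : ℤ) := Int.le_ceil _
      _ = x₀ := by rw [← hx₀, Int.cast_natCast]
  have hx₀le : (x₀ : ℚ) ≤ y₀ * q + L₁ := by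
    have : ⌈(y₀ : ℚ) * b / a⌉ ≤ y₀ * q + L₁ := by
      rw [Int.ceil_le, div_le_iff₀ haQ, hbq]
      push_cast
      have : (y₀ : ℚ) * r ≤ w * r :=
        mul_le_mul_of_nonneg_right (by exact_mod_cast hy₀w) hrQ.le
      linarith
    rw [← hx₀] at this
    exact_mod_cast this
  rw [← hx₀]
  norm_cast
  apply le_antisymm
  · refine L_le hx₀pos ((natCast_mod_le_iff_exists_int hb _ _).2 ⟨y₀, ?_, ?_⟩)
    · push_cast
      exact hx₀a
    · have := mul_le_mul_of_nonneg_right hx₀le hac.le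
      rw [hD] at hy₀D
      rw [hbq]
      push_cast
      linarith
  · obtain ⟨hx0, hxm⟩ := L_spec a hb hc.le
    generalize L a b c = x at *
    obtain ⟨y, hy1, hy2⟩ := (natCast_mod_le_iff_exists_int hb _ _).1 hxm
    push_cast at hy1 hy2
    have hxQ : (0 : ℚ) < x := by exact_mod_cast hx0
    have hyb : 0 < (y : ℚ) * b := by
      have := mul_pos hxQ hac
      linarith
    have hyQ : (0 : ℚ) < y := pos_of_mul_pos_left hyb hbQ.le
    have hzr : (y : ℚ) * r ≤ a * (x - y * q) := by
      rw [hbq] at hy1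
      linarith
    have hz0 : (0 : ℚ) < x - y * q :=
      pos_of_mul_pos_right ((mul_pos hyQ hrQ).trans_le hzr) haQ.le
    have hz0' : 0 < (x : ℤ) - y * q := by exact_mod_cast hz0
    obtain ⟨z, hz⟩ := Int.eq_ofNat_of_zero_le hz0'.le
    have hzQ : (x : ℚ) - y * q = z := by exact_mod_cast hz
    have hzD : z * ((a : ℚ) - c) ≤ y * D := by
      rw [hbq] at hy2
      rw [← hzQ, hD]
      linarith
    have hL₁z : L₁ ≤ z := by
      rw [hL₁]
      exact L_le (by omega) ((key z).2 ⟨y, by rwa [← hzQ], hzD⟩)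
    have hy₀y : y₀ ≤ y := by
      rw [hy₀, Int.ceil_le, div_le_iff₀ hD0]
      exact (mul_le_mul_of_nonneg_right (by exact_mod_cast hL₁z) hac.le).trans hzD
    have : ⌈(y₀ : ℚ) * b / a⌉ ≤ (x : ℤ) := by
      rw [Int.ceil_le, div_le_iff₀ haQ, Int.cast_natCast, mul_comm (x : ℚ)]
      exact (mul_le_mul_of_nonneg_right (by exact_mod_cast hy₀y) hbQ.le).trans hy1
    omega
end

section
/- Let a, b be positive integers and c a positive rational number with c < a < b and a not dividing b. For a positive integer z, the closed rational interval [ z·(a − c)/(c·⌊b/a⌋ + (b mod a)) , z·a/(b mod a) ] contains an integer if and only if z · ( c·b/(c·⌊b/a⌋ + (b mod a)) ) ≥ ( (z·a) mod (b mod a) ). -/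
theorem stmt_12 (a b : ℕ) (c : ℚ) (ha : 0 < a) (hb : 0 < b) (hc : 0 < c)
    (hca : c < (a : ℚ)) (hab : a < b) (hndvd : ¬ a ∣ b)
    (z : ℕ) (hz : 0 < z) :
    (∃ n : ℤ, (z : ℚ) * ((a : ℚ) - c) /
        (c * ((b / a : ℕ) : ℚ) + ((b % a : ℕ) : ℚ)) ≤ (n : ℚ) ∧
        (n : ℚ) ≤ (z : ℚ) * a / ((b % a : ℕ) : ℚ)) ↔
      ((z * a % (b % a) : ℕ) : ℚ) ≤
        (z : ℚ) * (c * b / (c * ((b / a : ℕ) : ℚ) + ((b % a : ℕ) : ℚ))) := by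
  have hr : 0 < b % a := Nat.emod_pos_of_not_dvd hndvd
  have hb_eq : (a : ℚ) * (b / a : ℕ) + (b % a : ℕ) = b := mod_cast Nat.div_add_mod b a
  generalize b / a = q at *
  generalize b % a = r at *
  have hz_eq : (r : ℚ) * (z * a / r : ℕ) + (z * a % r : ℕ) = z * a :=
    mod_cast Nat.div_add_mod (z * a) r
  have hfloor : ⌊(z : ℚ) * a / r⌋ = ((z * a / r : ℕ) : ℤ) := by
    exact_mod_cast Rat.floor_natCast_div_natCast (z * a) r
  have hr' : (0 : ℚ) < r := mod_cast hr
  have hD : 0 < c * q + (r : ℚ) := by positivity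
  have hexists : (∃ n : ℤ, (z : ℚ) * (a - c) / (c * q + r) ≤ n ∧ (n : ℚ) ≤ z * a / r) ↔
      (z : ℚ) * (a - c) / (c * q + r) ≤ (z * a / r : ℕ) := by
    constructor
    · rintro ⟨n, hn, hn'⟩
      rw [← Int.le_floor, hfloor] at hn'
      refine hn.trans ?_
      rw [← Int.cast_natCast (R := ℚ)]
      exact Int.cast_le.mpr hn'
    · intro h
      refine ⟨⌊(z : ℚ) * a / r⌋, ?_, Int.floor_le _⟩
      rw [hfloor]
      exact_mod_cast h
  rw [hexists, div_le_iff₀ hD, ← mul_div_assoc, le_div_iff₀ hD]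
  generalize z * a / r = N at *
  generalize z * a % r = m at *
  have key : (z : ℚ) * (c * b) - m * (c * q + r) = r * (N * (c * q + r) - z * (a - c)) := by
    linear_combination (-(z : ℚ) * c) * hb_eq - (c * q + r) * hz_eq
  rw [← sub_nonneg, ← sub_nonneg (b := (m : ℚ) * _), key, mul_nonneg_iff_of_pos_left hr']
end

section
/- Let a₁, a₂ be relatively prime positive integers and let u be a positive integer such that u·a₂ ≡ 1 (mod a₁). Then the numerical semigroup ⟨a₁,a₂⟩ = {λ₁·a₁ + λ₂·a₂ : λ₁, λ₂ ∈ ℕ} equals { x ∈ ℕ : (u·a₂·x mod (a₁·a₂)) ≤ x }. -/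
theorem stmt_14 (a₁ a₂ u : ℕ) (ha₁ : 0 < a₁) (ha₂ : 0 < a₂) (hu : 0 < u)
    (hcop : Nat.Coprime a₁ a₂) (hmod : u * a₂ ≡ 1 [MOD a₁]) :
    {x : ℕ | ∃ l₁ l₂ : ℕ, x = l₁ * a₁ + l₂ * a₂} =
      {x : ℕ | u * a₂ * x % (a₁ * a₂) ≤ x} := by
  have key : ∀ x, u * a₂ * x % (a₁ * a₂) = u * x % a₁ * a₂ := fun x => by
    rw [mul_right_comm, Nat.mul_mod_mul_right]
  ext x
  simp only [Set.mem_ofPred_eq, key]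
  constructor
  · rintro ⟨l₁, l₂, rfl⟩
    have h : u * (l₁ * a₁ + l₂ * a₂) ≡ l₂ [MOD a₁] := calc
      u * (l₁ * a₁ + l₂ * a₂) = u * a₂ * l₂ + a₁ * (u * l₁) := by ring
      _ ≡ u * a₂ * l₂ [MOD a₁] := by simp [Nat.ModEq]
      _ ≡ 1 * l₂ [MOD a₁] := hmod.mul_right l₂
      _ = l₂ := one_mul l₂
    calc u * (l₁ * a₁ + l₂ * a₂) % a₁ * a₂ = l₂ % a₁ * a₂ := by rw [h]
      _ ≤ l₂ * a₂ := Nat.mul_le_mul_right _ (Nat.mod_le _ _)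
      _ ≤ l₁ * a₁ + l₂ * a₂ := Nat.le_add_left _ _
  · intro hx
    have h : u * x % a₁ * a₂ ≡ x [MOD a₁] := calc
      u * x % a₁ * a₂ ≡ u * x * a₂ [MOD a₁] := (Nat.mod_modEq _ _).mul_right a₂
      _ = u * a₂ * x := by ring
      _ ≡ 1 * x [MOD a₁] := hmod.mul_right x
      _ = x := one_mul x
    obtain ⟨k, hk⟩ := (Nat.modEq_iff_dvd' hx).mp h
    exact ⟨k, u * x % a₁, by rw [mul_comm k, ← hk, Nat.sub_add_cancel hx]⟩
end

section
/- Let a₁, a₂ be relatively prime positive integers and let u be a positive integer such that u·a₂ ≡ 1 (mod a₁). Then ⟨a₁,a₂⟩ = { x ∈ ℕ : a₂·(u·x mod a₁) ≤ x }, i.e. x belongs to ⟨a₁,a₂⟩ if and only if (u·x mod a₁) ≤ x/a₂. -/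
theorem stmt_15 (a₁ a₂ u : ℕ) (ha₁ : 0 < a₁) (ha₂ : 0 < a₂) (hu : 0 < u)
    (hcop : Nat.Coprime a₁ a₂) (hmod : u * a₂ ≡ 1 [MOD a₁]) :
    {x : ℕ | ∃ l₁ l₂ : ℕ, x = l₁ * a₁ + l₂ * a₂} =
      {x : ℕ | a₂ * (u * x % a₁) ≤ x} := by
  ext x
  simp only [Set.mem_ofPred_eq]
  constructor
  · rintro ⟨l₁, l₂, rfl⟩
    have h : u * (l₁ * a₁ + l₂ * a₂) % a₁ = l₂ % a₁ := by
      calc u * (l₁ * a₁ + l₂ * a₂) % a₁ = (l₂ * (u * a₂) + a₁ * (u * l₁)) % a₁ := by ring_nf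
        _ = l₂ * (u * a₂) % a₁ := Nat.add_mul_mod_self_left _ _ _
        _ = l₂ * 1 % a₁ := hmod.mul_left l₂
        _ = l₂ % a₁ := by rw [mul_one]
    rw [h]
    calc a₂ * (l₂ % a₁) ≤ a₂ * l₂ := Nat.mul_le_mul_left _ (Nat.mod_le _ _)
      _ = l₂ * a₂ := mul_comm _ _
      _ ≤ l₁ * a₁ + l₂ * a₂ := Nat.le_add_left _ _
  · intro hx
    have h : a₂ * (u * x % a₁) ≡ x [MOD a₁] := by
      calc a₂ * (u * x % a₁) ≡ a₂ * (u * x) [MOD a₁] := (Nat.mod_modEq _ _).mul_left _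
        _ = u * a₂ * x := by ring
        _ ≡ 1 * x [MOD a₁] := hmod.mul_right x
        _ = x := one_mul x
    obtain ⟨k, hk⟩ := (Nat.modEq_iff_dvd' hx).mp h
    refine ⟨k, u * x % a₁, ?_⟩
    rw [mul_comm k, mul_comm _ a₂, ← hk, Nat.sub_add_cancel hx]
end

section
/- Let a₁, a₂ be relatively prime positive integers, let u be a positive integer with u·a₂ ≡ 1 (mod a₁), and let d be a positive integer. Then the multiplicity of the quotient semigroup ⟨a₁,a₂⟩/d = { x ∈ ℕ : x·d ∈ ⟨a₁,a₂⟩ }, i.e. the least positive x with x·d ∈ ⟨a₁,a₂⟩, equals L( (u·d) mod a₁, a₁, d/a₂ ). -/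
/-- For `u` an inverse of `a₂` modulo `a₁`, a natural number `n` lies in the numerical semigroup
generated by `a₁` and `a₂` iff `(u * n % a₁) * a₂ ≤ n`. -/
theorem exists_eq_mul_add_mul_iff_mod_mul_le {a₁ a₂ u : ℕ} (hmod : u * a₂ ≡ 1 [MOD a₁]) (n : ℕ) :
    (∃ l₁ l₂ : ℕ, n = l₁ * a₁ + l₂ * a₂) ↔ u * n % a₁ * a₂ ≤ n := by
  constructor
  · rintro ⟨l₁, l₂, h⟩
    have hl : u * n ≡ l₂ [MOD a₁] := by
      have h₁ : u * n = u * a₂ * l₂ + a₁ * (u * l₁) := by rw [h]; ring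
      have h₂ : u * a₂ * l₂ + a₁ * (u * l₁) ≡ u * a₂ * l₂ [MOD a₁] := by
        simp [Nat.ModEq]
      rw [h₁]
      exact h₂.trans (by simpa using hmod.mul_right l₂)
    have hle : u * n % a₁ ≤ l₂ := by
      rw [hl]
      exact Nat.mod_le _ _
    calc u * n % a₁ * a₂ ≤ l₂ * a₂ := Nat.mul_le_mul_right _ hle
      _ ≤ n := by omega
  · intro h
    have hn : u * n % a₁ * a₂ ≡ n [MOD a₁] := by
      have h₁ : u * n % a₁ * a₂ ≡ u * n * a₂ [MOD a₁] := (Nat.mod_modEq _ _).mul_right _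
      have h₂ : u * n * a₂ = u * a₂ * n := by ring
      rw [h₂] at h₁
      exact h₁.trans (by simpa using hmod.mul_right n)
    obtain ⟨k, hk⟩ := (Nat.modEq_iff_dvd' h).mp hn
    refine ⟨k, u * n % a₁, ?_⟩
    rw [mul_comm k, ← hk]
    omega

theorem stmt_16 (a₁ a₂ u d : ℕ) (ha₁ : 0 < a₁) (ha₂ : 0 < a₂) (hu : 0 < u)
    (hd : 0 < d) (hcop : Nat.Coprime a₁ a₂) (hmod : u * a₂ ≡ 1 [MOD a₁]) :
    sInf {x : ℕ | 0 < x ∧ ∃ l₁ l₂ : ℕ, x * d = l₁ * a₁ + l₂ * a₂} =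
      L (u * d % a₁) a₁ ((d : ℚ) / a₂) := by
  unfold L
  congr 1
  ext x
  have ha₂' : (0 : ℚ) < a₂ := by exact_mod_cast ha₂
  have hrem : u * d % a₁ * x % a₁ = u * (x * d) % a₁ := by
    rw [Nat.mod_mul_mod, mul_assoc, mul_comm d x]
  simp only [Set.mem_ofPred_eq]
  rw [exists_eq_mul_add_mul_iff_mod_mul_le hmod, hrem, div_mul_eq_mul_div, le_div_iff₀ ha₂',
    mul_comm (d : ℚ)]
  norm_cast
end

section
/- Let a₁, b₁, a₂, b₂ be positive integers such that b₁/a₁ < b₂/a₂. Then S([b₁/a₁, b₂/a₂]) = S(a₁·b₂, b₁·b₂, a₁·b₂ − a₂·b₁), i.e. the set of natural numbers that can be written as a finite sum of rational numbers lying in the interval [b₁/a₁, b₂/a₂] (together with 0) coincides with { x ∈ ℕ : (a₁·b₂·x mod (b₁·b₂)) ≤ (a₁·b₂ − a₂·b₁)·x }. -/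
/-- The additive submonoid generated by an interval is the union of its dilates by naturals. -/
theorem mem_closure_Icc_iff {p q x : ℚ} :
    x ∈ AddSubmonoid.closure (Set.Icc p q) ↔ ∃ k : ℕ, k * p ≤ x ∧ x ≤ k * q := by
  constructor
  · intro h
    induction h using AddSubmonoid.closure_induction with
    | mem y hy => exact ⟨1, by simpa using hy.1, by simpa using hy.2⟩
    | zero => exact ⟨0, by simp, by simp⟩
    | add y z _ _ hy hz =>
      obtain ⟨k, hk₁, hk₂⟩ := hy
      obtain ⟨l, hl₁, hl₂⟩ := hz
      refine ⟨k + l, ?_, ?_⟩ <;> push_cast <;> linarith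
  · rintro ⟨k, h₁, h₂⟩
    rcases Nat.eq_zero_or_pos k with rfl | hk
    · have hx : x = 0 := le_antisymm (by simpa using h₂) (by simpa using h₁)
      exact hx ▸ zero_mem _
    · have hk' : (0 : ℚ) < k := by exact_mod_cast hk
      have hx : x = k • (x / k) := by
        rw [nsmul_eq_mul]
        field_simp
      rw [hx]
      have hmem : x / k ∈ Set.Icc p q := by
        constructor
        · rw [le_div_iff₀ hk']
          linarith
        · rw [div_le_iff₀ hk']
          linarith
      exact nsmul_mem (AddSubmonoid.subset_closure hmem) k

theorem stmt_17 (a₁ b₁ a₂ b₂ : ℕ) (ha₁ : 0 < a₁) (hb₁ : 0 < b₁)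
    (ha₂ : 0 < a₂) (hb₂ : 0 < b₂)
    (hlt : (b₁ : ℚ) / a₁ < (b₂ : ℚ) / a₂) :
    {x : ℕ | (x : ℚ) ∈
        AddSubmonoid.closure (Set.Icc ((b₁ : ℚ) / a₁) ((b₂ : ℚ) / a₂))} =
      {x : ℕ | ((a₁ * b₂ * x % (b₁ * b₂) : ℕ) : ℤ) ≤
        ((a₁ : ℤ) * b₂ - (a₂ : ℤ) * b₁) * x} := by
  ext x
  simp only [Set.mem_ofPred_eq, mem_closure_Icc_iff]
  have clear_denominators (k : ℕ) :
      ((k : ℚ) * (b₁ / a₁) ≤ x ∧ (x : ℚ) ≤ k * (b₂ / a₂)) ↔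
        k * b₁ ≤ a₁ * x ∧ a₂ * x ≤ k * b₂ := by
    have h₁ : (0 : ℚ) < a₁ := by exact_mod_cast ha₁
    have h₂ : (0 : ℚ) < a₂ := by exact_mod_cast ha₂
    rw [← mul_div_assoc, ← mul_div_assoc, div_le_iff₀ h₁, le_div_iff₀ h₂,
      mul_comm (x : ℚ), mul_comm (x : ℚ)]
    norm_cast
  have floor_iff : (∃ k : ℕ, k * b₁ ≤ a₁ * x ∧ a₂ * x ≤ k * b₂) ↔
      a₂ * x ≤ a₁ * x / b₁ * b₂ := by
    constructor
    · rintro ⟨k, h₁, h₂⟩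
      exact h₂.trans (Nat.mul_le_mul_right _ ((Nat.le_div_iff_mul_le hb₁).2 h₁))
    · exact fun h => ⟨a₁ * x / b₁, Nat.div_mul_le_self _ _, h⟩
  simp only [clear_denominators, floor_iff]
  rw [mul_right_comm a₁ b₂ x, Nat.mul_mod_mul_right]
  have division : (b₁ : ℤ) * (a₁ * x / b₁ : ℕ) + (a₁ * x % b₁ : ℕ) = a₁ * x := by
    exact_mod_cast Nat.div_add_mod (a₁ * x) b₁
  have hb₁' : (0 : ℤ) < b₁ := by exact_mod_cast hb₁
  rw [← Int.ofNat_le, ← mul_le_mul_iff_right₀ hb₁']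
  generalize a₁ * x / b₁ = d at *
  generalize a₁ * x % b₁ = r at *
  push_cast
  have scaled := congrArg (· * (b₂ : ℤ)) division
  constructor <;> intro h <;> linarith
end
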